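/- arXiv:1912.01746 — 3 statements merged into one kernel-verified Lean document; each statement's English description precedes it below -/
import Mathlib

section
/- Let P and L be real 3×3 skew-symmetric matrices, and set F := L₁₂·P₁₂ + L₁₃·P₁₃ + L₂₃·P₂₃ + 1. If F ≠ 0, then P · (I − L·P)⁻¹ = F⁻¹ • P, i.e. the gauge-transformed matrix is the scalar multiple of P by 1/F. -/
open Matrix

theorem eq_of_transpose_eq_neg_fin_three {A : Matrix (Fin 3) (Fin 3) ℝ} (hA : Aᵀ = -A) :
    A = !![0, A 0 1, A 0 2; -A 0 1, 0, A 1 2; -A 0 2, -A 1 2, 0] := by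
  have h (i j : Fin 3) : A j i = -A i j := congr_fun₂ hA i j
  ext i j
  fin_cases i <;> fin_cases j <;> simp <;>
    linarith [h 0 0, h 1 1, h 2 2, h 0 1, h 0 2, h 1 2]

theorem skew_mul_one_sub_mul_skew {R : Type*} [CommRing R] (a b c x y z : R) :
    !![0, a, b; -a, 0, c; -b, -c, 0] *
        (1 - !![0, x, y; -x, 0, z; -y, -z, 0] * !![0, a, b; -a, 0, c; -b, -c, 0]) =
      (x * a + y * b + z * c + 1) • !![0, a, b; -a, 0, c; -b, -c, 0] := by
  ext i j
  fin_cases i <;> fin_cases j <;>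
    simp [Matrix.mul_apply, Fin.sum_univ_three] <;> ring

theorem det_one_sub_skew_mul_skew {R : Type*} [CommRing R] (a b c x y z : R) :
    (1 - !![0, x, y; -x, 0, z; -y, -z, 0] * !![0, a, b; -a, 0, c; -b, -c, 0]).det =
      (x * a + y * b + z * c + 1) ^ 2 := by
  simp [Matrix.det_fin_three]
  ring

/-- Pointwise formula for the gauge transformation on a 3-dimensional
manifold: if `F ≠ 0` then `P·(I − L·P)⁻¹ = F⁻¹ • P`. -/
theorem gauge_transformation_three
    (P L : Matrix (Fin 3) (Fin 3) ℝ)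
    (hP : Pᵀ = -P) (hL : Lᵀ = -L)
    (F : ℝ) (hF : F = L 0 1 * P 0 1 + L 0 2 * P 0 2 + L 1 2 * P 1 2 + 1)
    (hF0 : F ≠ 0) :
    P * (1 - L * P)⁻¹ = F⁻¹ • P := by
  have hmul : P * (1 - L * P) = F • P := by
    rw [eq_of_transpose_eq_neg_fin_three hP, eq_of_transpose_eq_neg_fin_three hL,
      skew_mul_one_sub_mul_skew, hF]
  have hdet : (1 - L * P).det = F ^ 2 := by
    rw [eq_of_transpose_eq_neg_fin_three hP, eq_of_transpose_eq_neg_fin_three hL,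
      det_one_sub_skew_mul_skew, hF]
  have hunit : IsUnit (1 - L * P).det := by
    rw [hdet]
    exact (pow_ne_zero 2 hF0).isUnit
  calc P * (1 - L * P)⁻¹ = F⁻¹ • (F • P) * (1 - L * P)⁻¹ := by rw [inv_smul_smul₀ hF0]
    _ = F⁻¹ • P := by
      rw [← hmul, Matrix.smul_mul, Matrix.mul_nonsing_inv_cancel_right _ _ hunit]
end

section
/- (Proposition 3.1, coordinate form on ℝ³.) Let Π, λ : ℝ³ → Matrix (Fin 3) (Fin 3) ℝ be maps with Π(x) and λ(x) skew-symmetric for all x, with Π differentiable, and let F : ℝ³ → ℝ be defined by F(x) := λ₁₂(x)Π¹²(x) + λ₁₃(x)Π¹³(x) + λ₂₃(x)Π²³(x) + 1. Set U := {x ∈ ℝ³ | F(x) ≠ 0}, which is open when F is continuous. Then for every x ∈ U: (i) the matrix I − λ(x)·Π(x) is invertible; (ii) Π(x)·(I − λ(x)·Π(x))⁻¹ = F(x)⁻¹ • Π(x); and (iii) if Π is a Poisson bivector field on ℝ³, then the bivector field Π̄ with Π̄(x) = F(x)⁻¹ • Π(x) is a Poisson bivector field on U. -/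
open Matrix

open Finset

/-- The Jacobiator of a bivector field `Π` on `ℝᵐ` given in coordinates:
`J(Π)ⁱʲᵏ(x) = Σₛ (Πˢⁱ ∂ₛΠʲᵏ + Πˢʲ ∂ₛΠᵏⁱ + Πˢᵏ ∂ₛΠⁱʲ)(x)`. -/
noncomputable def jacobiator {m : ℕ} (P : (Fin m → ℝ) → Matrix (Fin m) (Fin m) ℝ)
    (i j k : Fin m) (x : Fin m → ℝ) : ℝ :=
  ∑ s : Fin m,
    (P x s i * fderiv ℝ (fun y => P y j k) x (Pi.single s 1) +
     P x s j * fderiv ℝ (fun y => P y k i) x (Pi.single s 1) +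
     P x s k * fderiv ℝ (fun y => P y i j) x (Pi.single s 1))

theorem fderiv_smul_entry {m : ℕ} {P : (Fin m → ℝ) → Matrix (Fin m) (Fin m) ℝ}
    {f : (Fin m → ℝ) → ℝ} {x : Fin m → ℝ} (hf : DifferentiableAt ℝ f x) {i j : Fin m}
    (hP : DifferentiableAt ℝ (fun y => P y i j) x) (v : Fin m → ℝ) :
    fderiv ℝ (fun y => (f y • P y) i j) x v =
      f x * fderiv ℝ (fun y => P y i j) x v + P x i j * fderiv ℝ f x v := by
  simp only [Matrix.smul_apply, smul_eq_mul]
  rw [fderiv_fun_mul hf hP]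
  simp

/-- The Jacobiator of a conformal rescaling `f • P` of a bivector field. -/
theorem jacobiator_smul {m : ℕ} {P : (Fin m → ℝ) → Matrix (Fin m) (Fin m) ℝ}
    {f : (Fin m → ℝ) → ℝ} {x : Fin m → ℝ} (hf : DifferentiableAt ℝ f x)
    (hP : ∀ i j, DifferentiableAt ℝ (fun y => P y i j) x) (i j k : Fin m) :
    jacobiator (fun y => f y • P y) i j k x =
      f x ^ 2 * jacobiator P i j k x +
        f x * ∑ s, (P x s i * P x j k + P x s j * P x k i + P x s k * P x i j) *
          fderiv ℝ f x (Pi.single s 1) := by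
  simp only [jacobiator, fderiv_smul_entry hf (hP _ _), Finset.mul_sum,
    ← Finset.sum_add_distrib]
  refine Finset.sum_congr rfl fun s _ => ?_
  simp only [Matrix.smul_apply, smul_eq_mul]
  ring

theorem Matrix.apply_swap_of_transpose_eq_neg {n R : Type*} [Neg R] {A : Matrix n n R}
    (hA : Aᵀ = -A) (i j : n) : A j i = -A i j :=
  congrFun (congrFun hA i) j

theorem Matrix.apply_self_of_transpose_eq_neg {n : Type*} {A : Matrix n n ℝ}
    (hA : Aᵀ = -A) (i : n) : A i i = 0 :=
  self_eq_neg.mp (apply_swap_of_transpose_eq_neg hA i i)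

/-- In dimension three every bivector is decomposable: `A ∧ A = 0`, contracted once. -/
theorem skew_fin_three_plucker {A : Matrix (Fin 3) (Fin 3) ℝ} (hA : Aᵀ = -A) (s : Fin 3) :
    A s 0 * A 1 2 + A s 1 * A 2 0 + A s 2 * A 0 1 = 0 := by
  have swap := Matrix.apply_swap_of_transpose_eq_neg hA
  have diag := Matrix.apply_self_of_transpose_eq_neg hA
  fin_cases s <;> simp [diag, swap 0 1, swap 0 2, swap 1 2] <;> ring

theorem det_one_sub_mul_skew_fin_three {L A : Matrix (Fin 3) (Fin 3) ℝ}
    (hL : Lᵀ = -L) (hA : Aᵀ = -A) :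
    (1 - L * A).det = (L 0 1 * A 0 1 + L 0 2 * A 0 2 + L 1 2 * A 1 2 + 1) ^ 2 := by
  have swapA := Matrix.apply_swap_of_transpose_eq_neg hA
  have diagA := Matrix.apply_self_of_transpose_eq_neg hA
  have swapL := Matrix.apply_swap_of_transpose_eq_neg hL
  have diagL := Matrix.apply_self_of_transpose_eq_neg hL
  simp [Matrix.det_fin_three, Matrix.mul_apply, Fin.sum_univ_three, diagA, diagL,
    swapA 0 1, swapA 0 2, swapA 1 2, swapL 0 1, swapL 0 2, swapL 1 2]
  ring

theorem mul_one_sub_mul_skew_fin_three {L A : Matrix (Fin 3) (Fin 3) ℝ}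
    (hL : Lᵀ = -L) (hA : Aᵀ = -A) :
    A * (1 - L * A) = (L 0 1 * A 0 1 + L 0 2 * A 0 2 + L 1 2 * A 1 2 + 1) • A := by
  have swapA := Matrix.apply_swap_of_transpose_eq_neg hA
  have diagA := Matrix.apply_self_of_transpose_eq_neg hA
  have swapL := Matrix.apply_swap_of_transpose_eq_neg hL
  have diagL := Matrix.apply_self_of_transpose_eq_neg hL
  ext i j
  fin_cases i <;> fin_cases j <;>
    simp [Matrix.mul_apply, Fin.sum_univ_three, diagA, diagL,
      swapA 0 1, swapA 0 2, swapA 1 2, swapL 0 1, swapL 0 2, swapL 1 2] <;> ring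

/-- Proposition 3.1 in coordinate form on ℝ³: on the open set
`U = {F ≠ 0}`, where `F = ⟨λ,Π⟩ + 1`, the gauge transformation of `Π` by
`λ` is well defined, equals `F⁻¹ • Π`, and is Poisson whenever `Π` is. -/
theorem gauge_transformation_R3
    (P lam : (Fin 3 → ℝ) → Matrix (Fin 3) (Fin 3) ℝ)
    (hPskew : ∀ x, (P x)ᵀ = -(P x))
    (hLskew : ∀ x, (lam x)ᵀ = -(lam x))
    (hPdiff : ∀ i j : Fin 3, ∀ x, DifferentiableAt ℝ (fun y => P y i j) x)
    (F : (Fin 3 → ℝ) → ℝ)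
    (hF : ∀ x, F x = lam x 0 1 * P x 0 1 + lam x 0 2 * P x 0 2 + lam x 1 2 * P x 1 2 + 1)
    (U : Set (Fin 3 → ℝ)) (hU : U = {x | F x ≠ 0})
    (hFdiff : ∀ x ∈ U, DifferentiableAt ℝ F x) :
    (∀ x ∈ U, IsUnit (1 - lam x * P x)) ∧
    (∀ x ∈ U, P x * (1 - lam x * P x)⁻¹ = (F x)⁻¹ • P x) ∧
    ((∀ x, ∀ i j k : Fin 3, i < j → j < k → jacobiator P i j k x = 0) →
      ∀ x ∈ U, ∀ i j k : Fin 3, i < j → j < k →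
        jacobiator (fun y => (F y)⁻¹ • P y) i j k x = 0) := by
  subst hU
  have hunit : ∀ x ∈ {x | F x ≠ 0}, IsUnit (1 - lam x * P x) := fun x hx => by
    rw [Matrix.isUnit_iff_isUnit_det,
      det_one_sub_mul_skew_fin_three (hLskew x) (hPskew x), ← hF x]
    exact (pow_ne_zero 2 hx).isUnit
  refine ⟨hunit, fun x hx => ?_, fun hJ x hx i j k hij hjk => ?_⟩
  · have hdet := (Matrix.isUnit_iff_isUnit_det _).mp (hunit x hx)
    have hmul := mul_one_sub_mul_skew_fin_three (hLskew x) (hPskew x)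
    rw [← hF x] at hmul
    calc P x * (1 - lam x * P x)⁻¹
        = (F x)⁻¹ • (F x • P x) * (1 - lam x * P x)⁻¹ := by rw [inv_smul_smul₀ hx]
      _ = (F x)⁻¹ • P x := by
        rw [← hmul, Matrix.smul_mul, Matrix.mul_nonsing_inv_cancel_right _ _ hdet]
  · obtain ⟨rfl, rfl, rfl⟩ : i = 0 ∧ j = 1 ∧ k = 2 := by omega
    rw [jacobiator_smul (f := fun y => (F y)⁻¹) ((hFdiff x hx).fun_inv hx)
      (fun i j => hPdiff i j x), hJ x 0 1 2 hij hjk]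
    simp [skew_fin_three_plucker (hPskew x)]
end

section
/- (Lemma 3.2, second case.) Let a₁, a₄ ∈ ℝ and let Π be the bivector field on ℝ⁴ in coordinates with components Π¹²(x) = a₁x₂, Π¹³(x) = −a₁x₃, Π²³(x) = a₄x₁, and Π¹⁴(x) = Π²⁴(x) = Π³⁴(x) = 0 (and skew-symmetry). Then Π is a Poisson bivector field on ℝ⁴, i.e. J(Π)ⁱʲᵏ(x) = 0 for all x ∈ ℝ⁴ and all 1 ≤ i < j < k ≤ 4. -/
open Matrix

open Finset

/-- The coordinate derivatives of a rescaled coordinate function. -/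
lemma fderiv_const_mul_apply_single {m : ℕ} (c : ℝ) (i s : Fin m) (x : Fin m → ℝ) :
    fderiv ℝ (fun y : Fin m → ℝ => c * y i) x (Pi.single s 1) = if i = s then c else 0 := by
  have h : HasFDerivAt (fun y : Fin m → ℝ => c * y i)
      (c • ContinuousLinearMap.proj (R := ℝ) (φ := fun _ : Fin m => ℝ) i) x :=
    (hasFDerivAt_apply i x).const_mul c
  rw [h.fderiv]
  simp [Pi.single_apply]

/-- Lemma 3.2, second case: for `a₂ = −a₁` and `a₃ = 0`, the 2-parametric
family `Π = a₁x₂ ∂₁∧∂₂ − a₁x₃ ∂₁∧∂₃ + a₄x₁ ∂₂∧∂₃` is Poisson on ℝ⁴. -/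
theorem two_parametric_poisson
    (a₁ a₄ : ℝ)
    (P : (Fin 4 → ℝ) → Matrix (Fin 4) (Fin 4) ℝ)
    (hskew : ∀ x, (P x)ᵀ = -(P x))
    (h12 : ∀ x, P x 0 1 = a₁ * x 1)
    (h13 : ∀ x, P x 0 2 = -a₁ * x 2)
    (h23 : ∀ x, P x 1 2 = a₄ * x 0)
    (h14 : ∀ x, P x 0 3 = 0)
    (h24 : ∀ x, P x 1 3 = 0)
    (h34 : ∀ x, P x 2 3 = 0) :
    ∀ x : Fin 4 → ℝ, ∀ i j k : Fin 4, i < j → j < k →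
      jacobiator P i j k x = 0 := by
  have skew (x : Fin 4 → ℝ) (i j : Fin 4) : P x i j = -P x j i := by
    simpa using congrFun₂ (hskew x) j i
  have h31 (x) : P x 2 0 = a₁ * x 2 := by rw [skew, h13, neg_mul, neg_neg]
  have h32 (x) : P x 2 1 = -a₄ * x 0 := by rw [skew, h23, neg_mul]
  have h41 (x) : P x 3 0 = 0 := by rw [skew, h14, neg_zero]
  have h42 (x) : P x 3 1 = 0 := by rw [skew, h24, neg_zero]
  have diag (x) (i : Fin 4) : P x i i = 0 := self_eq_neg.mp (skew x i i)
  intro x i j k hij hjk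
  fin_cases i <;> fin_cases j <;> first
    | exact absurd hij (by decide)
    | (fin_cases k <;> first
        | exact absurd hjk (by decide)
        | (simp [jacobiator, Fin.sum_univ_four, h12, h13, h23, h14, h24, h34, h31, h32,
            h41, h42, diag, fderiv_const_mul_apply_single, -neg_mul]
           try ring))
end
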